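/- Let (Σ, d[a,b]) be a symbolic Barański carpet over a nonempty alphabet Γ ⊆ Γ₁ × Γ₂. Then for every p ∈ 𝒫(Γ), the Bernoulli measure ν_p satisfies dim_H ν_p = g(p,a,b), where the Hausdorff dimension is computed with respect to d[a,b]. -/

import Mathlib

open Set Filter MeasureTheory Metric
open scoped ENNReal NNReal

noncomputable section

/-- `p` is a probability vector indexed by `A` (entries outside `A` vanish). -/
def IsProbVec {Γ₁ Γ₂ : Type*} [Fintype Γ₁] [Fintype Γ₂] (A : Set (Γ₁ × Γ₂))
    (p : Γ₁ × Γ₂ → ℝ) : Prop :=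
  (∀ ij, 0 ≤ p ij) ∧ (∀ ij ∉ A, p ij = 0) ∧ ∑ ij : Γ₁ × Γ₂, p ij = 1

/-- Column sums `q_i(p)`. -/
def colSum {Γ₁ Γ₂ : Type*} [Fintype Γ₂] (p : Γ₁ × Γ₂ → ℝ) (i : Γ₁) : ℝ := ∑ j : Γ₂, p (i, j)

/-- Row sums `r_j(p)`. -/
def rowSum {Γ₁ Γ₂ : Type*} [Fintype Γ₁] (p : Γ₁ × Γ₂ → ℝ) (j : Γ₂) : ℝ := ∑ i : Γ₁, p (i, j)

/-- The first Lyapunov exponent `λ₁(p,a)`. -/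
def lyap1 {Γ₁ Γ₂ : Type*} [Fintype Γ₁] [Fintype Γ₂] (p : Γ₁ × Γ₂ → ℝ) (a : Γ₁ → ℝ) : ℝ :=
  ∑ ij : Γ₁ × Γ₂, p ij * Real.log (a ij.1)

/-- The second Lyapunov exponent `λ₂(p,b)`. -/
def lyap2 {Γ₁ Γ₂ : Type*} [Fintype Γ₁] [Fintype Γ₂] (p : Γ₁ × Γ₂ → ℝ) (b : Γ₂ → ℝ) : ℝ :=
  ∑ ij : Γ₁ × Γ₂, p ij * Real.log (b ij.2)

/-- `g₁(p,a,b)`. -/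
def gOne {Γ₁ Γ₂ : Type*} [Fintype Γ₁] [Fintype Γ₂] (p : Γ₁ × Γ₂ → ℝ) (a : Γ₁ → ℝ)
    (b : Γ₂ → ℝ) : ℝ :=
  (∑ ij : Γ₁ × Γ₂, p ij * Real.log (colSum p ij.1)) / lyap1 p a +
    ((∑ ij : Γ₁ × Γ₂, p ij * Real.log (p ij)) -
      ∑ ij : Γ₁ × Γ₂, p ij * Real.log (colSum p ij.1)) / lyap2 p b

/-- `g₂(p,a,b)`. -/
def gTwo {Γ₁ Γ₂ : Type*} [Fintype Γ₁] [Fintype Γ₂] (p : Γ₁ × Γ₂ → ℝ) (a : Γ₁ → ℝ)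
    (b : Γ₂ → ℝ) : ℝ :=
  (∑ ij : Γ₁ × Γ₂, p ij * Real.log (rowSum p ij.2)) / lyap2 p b +
    ((∑ ij : Γ₁ × Γ₂, p ij * Real.log (p ij)) -
      ∑ ij : Γ₁ × Γ₂, p ij * Real.log (rowSum p ij.2)) / lyap1 p a

/-- `g(p,a,b)`: equal to `g₁` when `λ₁(p,a) ≥ λ₂(p,b)` and to `g₂` otherwise. -/
noncomputable def gFun {Γ₁ Γ₂ : Type*} [Fintype Γ₁] [Fintype Γ₂] (p : Γ₁ × Γ₂ → ℝ)
    (a : Γ₁ → ℝ) (b : Γ₂ → ℝ) : ℝ :=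
  if lyap2 p b ≤ lyap1 p a then gOne p a b else gTwo p a b

/-- Generic "longest common prefix" distance on sequences: `0` for equal sequences, and
otherwise the value `val` of the longest common initial segment. -/
noncomputable def rhoDist {Γ : Type*} (val : List Γ → ℝ) (u v : ℕ → Γ) : ℝ := by
  classical
  exact if h : u = v then 0
    else val (List.ofFn fun k : Fin (Nat.find (Function.ne_iff.mp h)) => u k.val)

/-- The Barański distance `d[a,b]` on `Γ^ℕ` for `Γ = A ⊆ Γ₁ × Γ₂`:
`d[a,b]((𝚒₁,𝚓₁),(𝚒₂,𝚓₂)) = max {a_{𝚒₁∧𝚒₂}, b_{𝚓₁∧𝚓₂}}`. -/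
noncomputable def baranskiDist {Γ₁ Γ₂ : Type*} (A : Set (Γ₁ × Γ₂)) (a : Γ₁ → ℝ) (b : Γ₂ → ℝ)
    (ω₁ ω₂ : ℕ → ↥A) : ℝ :=
  max
    (rhoDist (fun L => (L.map a).prod)
      (fun k => ((ω₁ k : Γ₁ × Γ₂)).1) (fun k => ((ω₂ k : Γ₁ × Γ₂)).1))
    (rhoDist (fun L => (L.map b).prod)
      (fun k => ((ω₁ k : Γ₁ × Γ₂)).2) (fun k => ((ω₂ k : Γ₁ × Γ₂)).2))

/-- Hausdorff dimension of a measure: the infimum of Hausdorff dimensions of Borel sets of full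
measure. -/
noncomputable def dimHMeasure {E : Type*} [EMetricSpace E] [MeasurableSpace E]
    (μ : MeasureTheory.Measure E) : ℝ≥0∞ :=
  sInf {s | ∃ B : Set E, MeasurableSet B ∧ μ B = 1 ∧ dimH B = s}

/-- `ν` is the Bernoulli measure associated to the probability vector `p`: it gives each
cylinder the product of the `p`-weights of its letters. -/
def IsBernoulli {Γ₁ Γ₂ : Type*} [Fintype Γ₁] [Fintype Γ₂] (A : Set (Γ₁ × Γ₂))
    (p : Γ₁ × Γ₂ → ℝ) [MeasurableSpace (ℕ → ↥A)] (ν : MeasureTheory.Measure (ℕ → ↥A)) : Prop :=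
  ∀ (m : ℕ) (w : Fin m → ↥A),
    ν {ω | ∀ k : Fin m, ω k.val = w k} = ENNReal.ofReal (∏ k : Fin m, p (w k : Γ₁ × Γ₂))

section Billingsley

variable {X : Type*} [MetricSpace X] [IsUltrametricDist X]

theorem isOpen_ballSet (P : Set X → Prop) {r : ℝ} (hr : 0 < r) :
    IsOpen {x : X | P (closedBall x r)} := by
  rw [isOpen_iff_mem_nhds]
  intro x hx
  filter_upwards [closedBall_mem_nhds x hr] with y hy
  have := IsUltrametricDist.closedBall_eq_of_mem hy
  simp only [mem_ofPred_eq] at hx ⊢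
  rwa [← this]

theorem ediam_closedBall_ultra (x : X) (r : ℝ) : ediam (closedBall x r) ≤ ENNReal.ofReal r := by
  apply ediam_le
  intro y hy z hz
  rw [IsUltrametricDist.closedBall_eq_of_mem hy, mem_closedBall, dist_comm] at hz
  rw [edist_dist]
  exact ENNReal.ofReal_le_ofReal hz

variable [MeasurableSpace X] [BorelSpace X]

/-- Upper bound: sets where balls are massive. -/
theorem dimH_upper (ν : Measure X) [IsProbabilityMeasure ν] (t : ℝ≥0) (N : ℕ) :
    dimH {x : X | ∀ m : ℕ, N ≤ m →
      ENNReal.ofReal (Real.exp (-(m:ℝ) * t)) ≤ ν (closedBall x (Real.exp (-(m:ℝ))))} ≤ t := by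
  set E := {x : X | ∀ m : ℕ, N ≤ m →
      ENNReal.ofReal (Real.exp (-(m:ℝ) * t)) ≤ ν (closedBall x (Real.exp (-(m:ℝ))))} with hE
  apply dimH_le_of_hausdorffMeasure_ne_top
  let I : ℕ → Set (Set X) := fun m =>
    {S | ∃ x : X, S = closedBall x (Real.exp (-(m:ℝ))) ∧
      ENNReal.ofReal (Real.exp (-(m:ℝ) * t)) ≤ ν S}
  have hmeas : ∀ m, ∀ S : I m, MeasurableSet (S : Set X) := by
    rintro m ⟨S, x, rfl, -⟩
    exact measurableSet_closedBall
  have hpos : ∀ m, ∀ S : I m, 0 < ν (S : Set X) := by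
    rintro m ⟨S, x, rfl, h⟩
    exact lt_of_lt_of_le (by simp [Real.exp_pos]) h
  have hdisj : ∀ m, Pairwise (Function.onFun Disjoint (fun S : I m => (S : Set X))) := by
    rintro m ⟨S, x, rfl, h⟩ ⟨T, y, rfl, h'⟩ hne
    rcases IsUltrametricDist.closedBall_eq_or_disjoint x y (Real.exp (-(m:ℝ))) with h1 | h1
    · exact absurd (Subtype.ext h1) hne
    · exact h1
  have hcount : ∀ m, Countable (I m) := by
    intro m
    have := Measure.countable_meas_pos_of_disjoint_of_meas_iUnion_ne_top ν (hmeas m) (hdisj m)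
      (measure_ne_top _ _)
    have h2 : {i : I m | 0 < ν (i : Set X)} = univ := by
      ext i; simpa using hpos m i
    rw [h2] at this
    exact countable_univ_iff.mp this
  have hdiam : ∀ m, ∀ S : I m, ediam (S : Set X) ≤ ENNReal.ofReal (Real.exp (-(m:ℝ))) := by
    rintro m ⟨S, x, rfl, h⟩
    exact ediam_closedBall_ultra _ _
  have key := Measure.hausdorffMeasure_le_liminf_tsum (t : ℝ) E (l := atTop)
    (fun m : ℕ => ENNReal.ofReal (Real.exp (-(m:ℝ))))
    (by
      have : Tendsto (fun m : ℕ => Real.exp (-(m:ℝ))) atTop (nhds 0) :=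
        Real.tendsto_exp_neg_atTop_nhds_zero.comp tendsto_natCast_atTop_atTop
      simpa using ENNReal.tendsto_ofReal this)
    (fun m (S : I m) => (S : Set X)) (Eventually.of_forall hdiam)
    (by
      filter_upwards [eventually_ge_atTop N] with m hm x hx
      rw [mem_iUnion]
      refine ⟨⟨closedBall x (Real.exp (-(m:ℝ))), x, rfl, hx m hm⟩, ?_⟩
      exact mem_closedBall_self (Real.exp_pos _).le)
  have hone : ∀ m : ℕ, ∑' S : I m, ediam (S : Set X) ^ (t : ℝ) ≤ 1 := by
    intro m
    calc ∑' S : I m, ediam (S : Set X) ^ (t : ℝ) ≤ ∑' S : I m, ν (S : Set X) := by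
          apply ENNReal.tsum_le_tsum
          intro S
          refine le_trans (ENNReal.rpow_le_rpow (hdiam m S) t.2) ?_
          obtain ⟨S, x, hx, h⟩ := S
          refine le_trans (le_of_eq ?_) h
          rw [ENNReal.ofReal_rpow_of_pos (Real.exp_pos _), ← Real.exp_mul]
      _ = ν (⋃ S : I m, (S : Set X)) := (measure_iUnion (hdisj m) (hmeas m)).symm
      _ ≤ 1 := prob_le_one
  have : liminf (fun m : ℕ => ∑' S : I m, ediam (S : Set X) ^ (t : ℝ)) atTop ≤ 1 := by
    refine le_trans (liminf_le_liminf (v := fun _ => (1 : ℝ≥0∞)) (Eventually.of_forall hone)) ?_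
    simp
  exact ne_top_of_le_ne_top ENNReal.one_ne_top (key.trans this)

/-- Lower bound (mass distribution principle). -/
theorem dimH_lower (ν : Measure X) [IsProbabilityMeasure ν] (s : ℝ≥0) (hs : 0 < s) (N : ℕ)
    (B : Set X)
    (hB : ν (B ∩ {x : X | ∀ m : ℕ, N ≤ m →
      ν (closedBall x (Real.exp (-(m:ℝ)))) ≤ ENNReal.ofReal (Real.exp (-((m:ℝ) + 1) * s))}) ≠ 0) :
    (s : ℝ≥0∞) ≤ dimH B := by
  set F := {x : X | ∀ m : ℕ, N ≤ m →
      ν (closedBall x (Real.exp (-(m:ℝ)))) ≤ ENNReal.ofReal (Real.exp (-((m:ℝ) + 1) * s))} with hF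
  have hFm : MeasurableSet F := by
    have : F = ⋂ m : ℕ, ⋂ _ : N ≤ m, {x : X | ν (closedBall x (Real.exp (-(m:ℝ)))) ≤
        ENNReal.ofReal (Real.exp (-((m:ℝ) + 1) * s))} := by
      ext x; simp [hF]
    rw [this]
    refine MeasurableSet.iInter fun m => MeasurableSet.iInter fun _ => ?_
    exact (isOpen_ballSet (fun S => ν S ≤ ENNReal.ofReal (Real.exp (-((m:ℝ) + 1) * s)))
      (Real.exp_pos _)).measurableSet
  have hs' : (0 : ℝ) < s := by exact_mod_cast hs
  have hsub : ∀ (S : Set X) (x : X) (r : ℝ), x ∈ S → ediam S ≤ ENNReal.ofReal r → 0 ≤ r →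
      S ⊆ closedBall x r := by
    intro S x r hx hd hr y hy
    have := (edist_le_ediam_of_mem hy hx).trans hd
    rw [edist_dist, ENNReal.ofReal_le_ofReal_iff hr] at this
    exact this
  have hle : ν.restrict F ≤ μH[(s:ℝ)] := by
    apply Measure.le_hausdorffMeasure (s : ℝ) _ (ENNReal.ofReal (Real.exp (-(N:ℝ))))
      (by simp [Real.exp_pos])
    intro S hS
    rw [Measure.restrict_apply' hFm]
    rcases (S ∩ F).eq_empty_or_nonempty with he | ⟨x, hxS, hxF⟩
    · simp [he]
    have hbound : ∀ m : ℕ, N ≤ m → ediam S ≤ ENNReal.ofReal (Real.exp (-(m:ℝ))) →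
        ν (S ∩ F) ≤ ENNReal.ofReal (Real.exp (-((m:ℝ) + 1) * s)) := by
      intro m hm hd
      exact (measure_mono (inter_subset_left.trans
        (hsub S x _ hxS hd (Real.exp_pos _).le))).trans (hxF m hm)
    have hlim : Tendsto (fun m : ℕ => Real.exp (-(m:ℝ))) atTop (nhds 0) :=
        Real.tendsto_exp_neg_atTop_nhds_zero.comp tendsto_natCast_atTop_atTop
    rcases eq_or_ne (ediam S) 0 with h0 | h0
    · rw [h0, ENNReal.zero_rpow_of_pos hs']
      have h1 : Tendsto (fun m : ℕ => ENNReal.ofReal (Real.exp (-((m:ℝ) + 1) * s))) atTop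
          (nhds 0) := by
        have : Tendsto (fun m : ℕ => Real.exp (-(((m:ℝ) + 1) * s))) atTop (nhds 0) := by
          apply Real.tendsto_exp_neg_atTop_nhds_zero.comp
          apply Tendsto.atTop_mul_const hs'
          exact tendsto_atTop_add_const_right _ _ tendsto_natCast_atTop_atTop
        simp only [neg_mul]
        simpa only [ENNReal.ofReal_zero] using ENNReal.tendsto_ofReal this
      apply ge_of_tendsto h1
      filter_upwards [eventually_ge_atTop N] with m hm
      exact hbound m hm (by simp [h0])
    · have hfin : ediam S ≠ ⊤ := ne_top_of_le_ne_top ENNReal.ofReal_ne_top hS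
      obtain ⟨d, hd0, hd⟩ : ∃ d : ℝ, 0 < d ∧ ediam S = ENNReal.ofReal d :=
        ⟨(ediam S).toReal, ENNReal.toReal_pos h0 hfin, (ENNReal.ofReal_toReal hfin).symm⟩
      have hex : ∃ m : ℕ, Real.exp (-(m:ℝ)) < d :=
        (hlim.eventually (gt_mem_nhds hd0)).exists
      classical
      have hf := Nat.find_spec hex
      set M := Nat.find hex with hM
      rw [hd, ENNReal.ofReal_le_ofReal_iff (Real.exp_pos _).le] at hS
      have hNM : N < M := by
        by_contra hcon
        have : (M:ℝ) ≤ N := by exact_mod_cast not_lt.mp hcon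
        have : Real.exp (-(N:ℝ)) ≤ Real.exp (-(M:ℝ)) := Real.exp_le_exp.mpr (by linarith)
        linarith
      obtain ⟨m, hm⟩ : ∃ m, M = m + 1 := ⟨M - 1, by omega⟩
      have hnot := Nat.find_min hex (m := m) (by omega)
      have := hbound m (by omega) (by
        rw [hd]; exact ENNReal.ofReal_le_ofReal (not_lt.mp hnot))
      refine this.trans ?_
      rw [hd, ENNReal.ofReal_rpow_of_pos hd0]
      apply ENNReal.ofReal_le_ofReal
      rw [Real.exp_mul]
      apply Real.rpow_le_rpow (Real.exp_pos _).le _ hs'.le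
      rw [hm] at hf
      push_cast at hf
      exact hf.le
  apply le_dimH_of_hausdorffMeasure_ne_zero
  intro h
  apply hB
  have := hle B
  rw [Measure.restrict_apply' hFm, h] at this
  exact le_antisymm this zero_le

theorem billingsley (ν : Measure X) [IsProbabilityMeasure ν] (g : ℝ)
    (h : ∀ᵐ x ∂ν, ∃ L : ℕ → ℝ,
      (∀ m : ℕ, ν (closedBall x (Real.exp (-(m:ℝ)))) = ENNReal.ofReal (Real.exp (-(L m)))) ∧
      Tendsto (fun m : ℕ => L m / m) atTop (nhds g)) :
    dimHMeasure ν = ENNReal.ofReal g := by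
  apply le_antisymm
  · apply le_of_forall_gt
    intro c hc
    obtain ⟨t, ht1, ht2⟩ := ENNReal.lt_iff_exists_nnreal_btwn.mp hc
    have htg : g < t := by
      by_contra hcon
      have := ENNReal.ofReal_le_ofReal (not_lt.mp hcon)
      rw [ENNReal.ofReal_coe_nnreal] at this
      exact absurd ht1 (not_lt.mpr this)
    let E : ℕ → Set X := fun N => {x : X | ∀ m : ℕ, N ≤ m →
      ENNReal.ofReal (Real.exp (-(m:ℝ) * t)) ≤ ν (closedBall x (Real.exp (-(m:ℝ))))}
    have hEm : ∀ N, MeasurableSet (E N) := by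
      intro N
      have : E N = ⋂ m : ℕ, ⋂ _ : N ≤ m, {x : X |
          ENNReal.ofReal (Real.exp (-(m:ℝ) * t)) ≤ ν (closedBall x (Real.exp (-(m:ℝ))))} := by
        ext x; simp [E]
      rw [this]
      refine MeasurableSet.iInter fun m => MeasurableSet.iInter fun _ => ?_
      exact (isOpen_ballSet (fun S => ENNReal.ofReal (Real.exp (-(m:ℝ) * t)) ≤ ν S)
        (Real.exp_pos _)).measurableSet
    have hfull : ∀ᵐ x ∂ν, x ∈ ⋃ N, E N := by
      filter_upwards [h] with x hx
      obtain ⟨L, hL, hlim⟩ := hx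
      have h1 := hlim.eventually (gt_mem_nhds htg)
      obtain ⟨N, hN⟩ := eventually_atTop.mp (h1.and (eventually_gt_atTop 0))
      rw [mem_iUnion]
      refine ⟨N, fun m hm => ?_⟩
      rw [hL]
      apply ENNReal.ofReal_le_ofReal
      obtain ⟨h2, h3⟩ := hN m hm
      have h3' : (0:ℝ) < m := by exact_mod_cast h3
      rw [div_lt_iff₀ h3'] at h2
      apply Real.exp_le_exp.mpr
      nlinarith
    have hdim : dimH (⋃ N, E N) ≤ t := by
      rw [dimH_iUnion]
      exact iSup_le fun N => dimH_upper ν t N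
    refine lt_of_le_of_lt ?_ ht2
    refine le_trans ?_ hdim
    exact sInf_le ⟨_, MeasurableSet.iUnion hEm, (mem_ae_iff_prob_eq_one (MeasurableSet.iUnion hEm)).mp hfull, rfl⟩
  · apply le_sInf
    rintro _ ⟨B, hBm, hB, rfl⟩
    apply le_of_forall_lt
    intro c hc
    obtain ⟨s, hs1, hs2⟩ := ENNReal.lt_iff_exists_nnreal_btwn.mp hc
    refine hs1.trans_le ?_
    have hsg : (s:ℝ) < g := by
      rw [ENNReal.coe_lt_ofReal] at hs2
      exact hs2
    have hs0 : 0 < s := by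
      have : (0:ℝ≥0∞) < s := bot_le.trans_lt hs1
      exact_mod_cast this
    let F : ℕ → Set X := fun N => {x : X | ∀ m : ℕ, N ≤ m →
      ν (closedBall x (Real.exp (-(m:ℝ)))) ≤ ENNReal.ofReal (Real.exp (-((m:ℝ) + 1) * s))}
    have hfull : ∀ᵐ x ∂ν, x ∈ ⋃ N, F N := by
      filter_upwards [h] with x hx
      obtain ⟨L, hL, hlim⟩ := hx
      have h1 : Tendsto (fun m : ℕ => L m / m - s / m) atTop (nhds (g - 0)) :=
        hlim.sub (tendsto_const_div_atTop_nhds_zero_nat _)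
      rw [sub_zero] at h1
      obtain ⟨N, hN⟩ := eventually_atTop.mp
        ((h1.eventually (lt_mem_nhds hsg)).and (eventually_gt_atTop 0))
      rw [mem_iUnion]
      refine ⟨N, fun m hm => ?_⟩
      rw [hL]
      apply ENNReal.ofReal_le_ofReal
      obtain ⟨h2, h3⟩ := hN m hm
      have h3' : (0:ℝ) < m := by exact_mod_cast h3
      rw [← sub_div, lt_div_iff₀ h3'] at h2
      apply Real.exp_le_exp.mpr
      nlinarith
    have hBf : ν (⋃ N, (B ∩ F N)) = 1 := by
      rw [← inter_iUnion]
      have hBae : ∀ᵐ x ∂ν, x ∈ B := (mem_ae_iff_prob_eq_one hBm).mpr hB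
      rw [← measure_univ (μ := ν)]
      apply measure_congr
      filter_upwards [hfull, hBae] with x h1 h2
      apply propext
      exact ⟨fun _ => trivial, fun _ => ⟨h2, h1⟩⟩
    have : ∃ N, ν (B ∩ F N) ≠ 0 := by
      by_contra hcon
      push Not at hcon
      rw [measure_iUnion_null hcon] at hBf
      exact zero_ne_one hBf
    obtain ⟨N, hN⟩ := this
    exact dimH_lower ν s hs0 N B hN

end Billingsley

section Prob

theorem cyl_prod {Ω α : Type*} [MeasurableSpace Ω] (μ : Measure Ω) [Fintype α] [DecidableEq α]
    (Y : ℕ → Ω → α) (hY : ∀ k c, MeasurableSet {ω | Y k ω = c}) (P : α → ℝ)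
    (hP0 : ∀ c, 0 ≤ P c)
    (hμ : ∀ (m : ℕ) (w : Fin m → α),
      μ {ω | ∀ k : Fin m, Y k ω = w k} = ENNReal.ofReal (∏ k, P (w k)))
    (m : ℕ) (S : ℕ → Finset α) :
    μ {ω | ∀ k < m, Y k ω ∈ S k} = ENNReal.ofReal (∏ k ∈ Finset.range m, ∑ c ∈ S k, P c) := by
  have h1 : {ω | ∀ k < m, Y k ω ∈ S k} =
      ⋃ w ∈ Fintype.piFinset (fun k : Fin m => S k), {ω | ∀ k : Fin m, Y k ω = w k} := by
    ext ω
    simp only [mem_ofPred_eq, mem_iUnion, Fintype.mem_piFinset, exists_prop]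
    constructor
    · intro h
      exact ⟨fun k => Y k ω, fun k => h k k.2, fun k => rfl⟩
    · rintro ⟨w, hw, h⟩ k hk
      have := h ⟨k, hk⟩
      simp only at this
      rw [this]
      exact hw ⟨k, hk⟩
  rw [h1, measure_biUnion_finset]
  · simp_rw [hμ]
    rw [← ENNReal.ofReal_sum_of_nonneg (fun w _ => Finset.prod_nonneg fun k _ => hP0 _)]
    congr 1
    rw [Finset.prod_range (fun k => ∑ c ∈ S k, P c), Finset.prod_univ_sum]
  · intro w _ w' _ hne
    rw [Function.onFun, Set.disjoint_left]
    intro ω h h'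
    apply hne
    funext k
    rw [← h k, ← h' k]
  · intro w _
    have : {ω | ∀ k : Fin m, Y k ω = w k} = ⋂ k : Fin m, {ω | Y k ω = w k} := by
      ext; simp
    rw [this]
    exact MeasurableSet.iInter fun k => hY _ _

theorem slln_fin {Ω α : Type*} [MeasurableSpace Ω] (μ : Measure Ω) [IsProbabilityMeasure μ]
    [Fintype α]
    (Y : ℕ → Ω → α) (hY : ∀ k c, MeasurableSet {ω | Y k ω = c}) (P : α → ℝ)
    (hP0 : ∀ c, 0 ≤ P c) (hP1 : ∑ c, P c = 1)
    (hμ : ∀ (m : ℕ) (w : Fin m → α),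
      μ {ω | ∀ k : Fin m, Y k ω = w k} = ENNReal.ofReal (∏ k, P (w k))) (f : α → ℝ) :
    ∀ᵐ ω ∂μ, Tendsto (fun n : ℕ => (∑ k ∈ Finset.range n, f (Y k ω)) / n) atTop
      (nhds (∑ c, P c * f c)) := by
  classical
  let _ : MeasurableSpace α := ⊤
  have hYm : ∀ k, Measurable (Y k) := fun k => measurable_to_countable' fun c => hY k c
  have hone : ∀ k c, μ {ω | Y k ω = c} = ENNReal.ofReal (P c) := by
    intro k c
    have := cyl_prod μ Y hY P hP0 hμ (k+1) (fun l => if l = k then {c} else Finset.univ)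
    have h2 : {ω | ∀ l < k+1, Y l ω ∈ (if l = k then ({c} : Finset α) else Finset.univ)} =
        {ω | Y k ω = c} := by
      ext ω
      simp only [mem_ofPred_eq]
      constructor
      · intro h
        simpa using h k (by omega)
      · intro h l _
        split_ifs with h3
        · simp [h3, h]
        · simp
    rw [h2] at this
    rw [this, Finset.prod_range_succ, Finset.prod_eq_one]
    · simp
    · intro l hl
      have := Finset.mem_range.mp hl
      rw [if_neg (by omega), hP1]
  have htwo : ∀ k l c d, k ≠ l → μ {ω | Y k ω = c ∧ Y l ω = d} = ENNReal.ofReal (P c * P d) := by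
    intro k l c d hkl
    have := cyl_prod μ Y hY P hP0 hμ (k+l+1)
      (fun i => if i = k then {c} else if i = l then {d} else Finset.univ)
    have h2 : {ω | ∀ i < k+l+1, Y i ω ∈ (if i = k then ({c} : Finset α) else
        if i = l then {d} else Finset.univ)} = {ω | Y k ω = c ∧ Y l ω = d} := by
      ext ω
      simp only [mem_ofPred_eq]
      constructor
      · intro h
        exact ⟨by simpa using h k (by omega), by simpa [hkl.symm] using h l (by omega)⟩
      · rintro ⟨h, h'⟩ i _
        split_ifs with h3 h4
        · simp [h3, h]
        · simp [h4, h']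
        · simp
    rw [h2] at this
    rw [this]
    congr 1
    rw [← Finset.prod_subset (s₁ := {k, l})]
    · rw [Finset.prod_pair hkl]
      simp [hkl.symm]
    · intro i hi
      simp only [Finset.mem_insert, Finset.mem_singleton] at hi
      simp only [Finset.mem_range]
      omega
    · intro i _ hi
      simp only [Finset.mem_insert, Finset.mem_singleton, not_or] at hi
      rw [if_neg hi.1, if_neg hi.2, hP1]
  have hmap : ∀ k, μ.map (Y k) = μ.map (Y 0) := by
    intro k
    apply Measure.ext_of_singleton
    intro c
    rw [Measure.map_apply (hYm k) (measurableSet_singleton c),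
      Measure.map_apply (hYm 0) (measurableSet_singleton c)]
    exact (hone k c).trans (hone 0 c).symm
  have hf : Measurable f := measurable_from_top
  have hindep : ∀ k l, k ≠ l → ProbabilityTheory.IndepFun (Y k) (Y l) μ := by
    intro k l hkl
    rw [ProbabilityTheory.indepFun_iff_map_prod_eq_prod_map_map (hYm k).aemeasurable
      (hYm l).aemeasurable]
    apply Measure.ext_of_singleton
    rintro ⟨c, d⟩
    rw [Measure.map_apply ((hYm k).prodMk (hYm l)) (measurableSet_singleton _),
      ← Set.singleton_prod_singleton, Measure.prod_prod,
      Measure.map_apply (hYm k) (measurableSet_singleton c),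
      Measure.map_apply (hYm l) (measurableSet_singleton d)]
    have e1 : (fun ω => (Y k ω, Y l ω)) ⁻¹' ({c} ×ˢ {d}) = {ω | Y k ω = c ∧ Y l ω = d} := by
      ext; simp
    rw [e1, htwo k l c d hkl, ENNReal.ofReal_mul (hP0 c), ← hone k c, ← hone l d]
    rfl
  have hbd : ∃ C, ∀ c, ‖f c‖ ≤ C := by
    refine ⟨∑ c, ‖f c‖, fun c => ?_⟩
    exact Finset.single_le_sum (f := fun c => ‖f c‖) (fun _ _ => norm_nonneg _) (Finset.mem_univ c)
  obtain ⟨C, hC⟩ := hbd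
  have hmain := ProbabilityTheory.strong_law_ae_real (μ := μ) (fun k ω => f (Y k ω))
    (Integrable.of_bound ((hf.comp (hYm 0)).aestronglyMeasurable) C
      (Eventually.of_forall fun ω => hC _))
    (fun k l hkl => (hindep k l hkl).comp hf hf)
    (fun k => ⟨(hf.comp (hYm k)).aemeasurable, (hf.comp (hYm 0)).aemeasurable, by
      have e : ∀ k, μ.map (fun ω => f (Y k ω)) = (μ.map (Y k)).map f := fun k =>
        (Measure.map_map hf (hYm k)).symm
      rw [e, e, hmap]⟩)
  have hint : ∫ ω, f (Y 0 ω) ∂μ = ∑ c, P c * f c := by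
    have : ∫ ω, f (Y 0 ω) ∂μ = ∫ c, f c ∂(μ.map (Y 0)) :=
      (integral_map (hYm 0).aemeasurable hf.aestronglyMeasurable).symm
    rw [this, integral_fintype]
    · refine Finset.sum_congr rfl fun c _ => ?_
      rw [smul_eq_mul, Measure.real, Measure.map_apply (hYm 0) (measurableSet_singleton c)]
      congr 1
      have := hone 0 c
      change (μ {ω | Y 0 ω = c}).toReal = _
      rw [this, ENNReal.toReal_ofReal (hP0 c)]
    · have : IsProbabilityMeasure (μ.map (Y 0)) := Measure.isProbabilityMeasure_map (hYm 0).aemeasurable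
      exact Integrable.of_bound hf.aestronglyMeasurable C (Eventually.of_forall hC)
  rw [← hint]
  exact hmain

theorem ae_pos {Ω α : Type*} [MeasurableSpace Ω] (μ : Measure Ω) [IsProbabilityMeasure μ]
    [Fintype α]
    (Y : ℕ → Ω → α) (hY : ∀ k c, MeasurableSet {ω | Y k ω = c}) (P : α → ℝ)
    (hP0 : ∀ c, 0 ≤ P c)
    (hμ : ∀ (m : ℕ) (w : Fin m → α),
      μ {ω | ∀ k : Fin m, Y k ω = w k} = ENNReal.ofReal (∏ k, P (w k))) :
    ∀ᵐ ω ∂μ, ∀ k, 0 < P (Y k ω) := by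
  classical
  rw [ae_all_iff]
  intro k
  have := cyl_prod μ Y hY P hP0 hμ (k+1)
    (fun l => if l = k then Finset.univ.filter (fun c => P c = 0) else Finset.univ)
  rw [Finset.prod_range_succ] at this
  have h0 : ∑ c ∈ (if k = k then Finset.univ.filter (fun c => P c = 0) else Finset.univ), P c
      = 0 := by
    rw [if_pos rfl]
    exact Finset.sum_eq_zero fun c hc => (Finset.mem_filter.mp hc).2
  rw [h0, mul_zero, ENNReal.ofReal_zero] at this
  rw [ae_iff]
  refine measure_mono_null ?_ this
  intro ω hω l hl
  split_ifs with h
  · subst h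
    have := hP0 (Y l ω)
    simp only [mem_ofPred_eq, not_lt] at hω
    simp [le_antisymm hω this]
  · simp

end Prob

section Asymp

/-- Stopping index asymptotics. -/
theorem stop_asymp (c : ℕ → ℝ) (C lam : ℝ) (hC : ∀ k, -C ≤ c k) (hlam : lam < 0)
    (hlim : Tendsto (fun n : ℕ => (∑ k ∈ Finset.range n, c k) / n) atTop (nhds lam))
    (n : ℕ → ℕ) (h1 : ∀ m : ℕ, ∑ k ∈ Finset.range (n m), c k ≤ -(m:ℝ))
    (h2 : ∀ m l : ℕ, l < n m → -(m:ℝ) < ∑ k ∈ Finset.range l, c k) :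
    Tendsto n atTop atTop ∧ Tendsto (fun m : ℕ => (n m : ℝ) / m) atTop (nhds (-1 / lam)) := by
  have hlow : ∀ l : ℕ, -(C * l) ≤ ∑ k ∈ Finset.range l, c k := by
    intro l
    have := Finset.card_nsmul_le_sum (Finset.range l) c (-C) (fun k _ => hC k)
    simp only [Finset.card_range, nsmul_eq_mul] at this
    linarith
  have hn : Tendsto n atTop atTop := by
    rw [tendsto_atTop_atTop]
    intro K
    obtain ⟨M, hM⟩ := exists_nat_gt (|C| * K)
    refine ⟨M, fun m hm => ?_⟩
    by_contra hcon
    have a1 := h1 m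
    have a2 := hlow (n m)
    have a3 : (n m : ℝ) ≤ K := by exact_mod_cast (not_le.mp hcon).le
    have a4 : (M:ℝ) ≤ m := by exact_mod_cast hm
    have a5 : C * n m ≤ |C| * K :=
      (mul_le_mul_of_nonneg_right (le_abs_self C) (Nat.cast_nonneg _)).trans
        (mul_le_mul_of_nonneg_left a3 (abs_nonneg C))
    linarith
  refine ⟨hn, ?_⟩
  have hS1 : Tendsto (fun m : ℕ => (∑ k ∈ Finset.range (n m), c k) / (n m : ℕ)) atTop (nhds lam) :=
    hlim.comp hn
  have hS2 : Tendsto (fun m : ℕ => (∑ k ∈ Finset.range (n m), c k) / m) atTop (nhds (-1)) := by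
    have hl : Tendsto (fun m : ℕ => -1 - C / m) atTop (nhds (-1)) := by
      simpa using (tendsto_const_nhds (x := (-1:ℝ))).sub (tendsto_const_div_atTop_nhds_zero_nat C)
    refine tendsto_of_tendsto_of_tendsto_of_le_of_le' hl tendsto_const_nhds ?_ ?_
    · filter_upwards [eventually_gt_atTop 0, hn.eventually (eventually_gt_atTop 0)] with m hm hnm
      have hm' : (0:ℝ) < m := by exact_mod_cast hm
      rw [le_div_iff₀ hm', sub_mul, div_mul_cancel₀ _ hm'.ne']
      obtain ⟨l, hl⟩ : ∃ l, n m = l + 1 := ⟨n m - 1, by omega⟩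
      have := h2 m l (by omega)
      rw [hl, Finset.sum_range_succ]
      have := hC l
      linarith
    · filter_upwards [eventually_gt_atTop 0] with m hm
      have hm' : (0:ℝ) < m := by exact_mod_cast hm
      rw [div_le_iff₀ hm']
      have := h1 m
      linarith
  have hdiv := hS2.div hS1 hlam.ne
  refine hdiv.congr' ?_
  filter_upwards [eventually_gt_atTop 0, hn.eventually (eventually_gt_atTop 0)] with m hm hnm
  have hm' : (0:ℝ) < m := by exact_mod_cast hm
  have hn' : (0:ℝ) < n m := by exact_mod_cast hnm
  have : ∑ k ∈ Finset.range (n m), c k < 0 := by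
    have := h1 m
    linarith
  simp only [Pi.div_apply]
  field_simp
  exact div_self this.ne

theorem comp_asymp (c : ℕ → ℝ) (h t : ℝ)
    (hlim : Tendsto (fun n : ℕ => (∑ k ∈ Finset.range n, c k) / n) atTop (nhds h))
    (n : ℕ → ℕ) (hn : Tendsto n atTop atTop)
    (ht : Tendsto (fun m : ℕ => (n m : ℝ) / m) atTop (nhds t)) :
    Tendsto (fun m : ℕ => (∑ k ∈ Finset.range (n m), c k) / m) atTop (nhds (h * t)) := by
  have h1 := (hlim.comp hn).mul ht
  refine h1.congr' ?_
  filter_upwards [hn.eventually (eventually_gt_atTop 0)] with m hnm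
  have hn' : (0:ℝ) < n m := by exact_mod_cast hnm
  simp only [Function.comp]
  field_simp

end Asymp

section Metric

theorem rhoDist_le_iff {G : Type*} (a : G → ℝ) (ha : ∀ i, a i ∈ Set.Ioo (0:ℝ) 1) [Finite G]
    (u v : ℕ → G) (r : ℝ) (hr : 0 < r) :
    rhoDist (fun L => (L.map a).prod) u v ≤ r ↔
      ∃ n : ℕ, (∀ k < n, u k = v k) ∧ ∏ k ∈ Finset.range n, a (u k) ≤ r := by
  classical
  unfold rhoDist
  split_ifs with h
  · subst h
    refine ⟨fun _ => ?_, fun _ => hr.le⟩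
    have : Nonempty G := ⟨u 0⟩
    obtain ⟨i0, hi0⟩ := Finite.exists_max a
    obtain ⟨n, hn⟩ := exists_pow_lt_of_lt_one hr (ha i0).2
    refine ⟨n, fun _ _ => rfl, le_trans ?_ hn.le⟩
    calc ∏ k ∈ Finset.range n, a (u k) ≤ ∏ k ∈ Finset.range n, a i0 :=
          Finset.prod_le_prod (fun k _ => (ha _).1.le) (fun k _ => hi0 _)
      _ = a i0 ^ n := by simp
  · have hspec := Nat.find_spec (Function.ne_iff.mp h)
    have hmin := fun m => Nat.find_min (Function.ne_iff.mp h) (m := m)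
    set N := Nat.find (Function.ne_iff.mp h) with hN
    have e : (List.map a (List.ofFn fun k : Fin N => u k.val)).prod =
        ∏ k ∈ Finset.range N, a (u k) := by
      rw [List.map_ofFn, List.prod_ofFn, Finset.prod_range]
      rfl
    simp only [e]
    constructor
    · intro hle
      exact ⟨N, fun k hk => not_not.mp (hmin k hk), hle⟩
    · rintro ⟨n, hn, hle⟩
      have hnN : n ≤ N := by
        by_contra hcon
        exact hspec (hn N (by omega))
      refine le_trans ?_ hle
      rw [← Finset.prod_range_mul_prod_Ico _ hnN]
      apply mul_le_of_le_one_right (Finset.prod_nonneg fun k _ => (ha _).1.le)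
      exact Finset.prod_le_one (fun k _ => (ha _).1.le) (fun k _ => (ha _).2.le)

theorem rhoDist_trans {G : Type*} (a : G → ℝ) (ha : ∀ i, a i ∈ Set.Ioo (0:ℝ) 1) [Finite G]
    (u v w : ℕ → G) (r : ℝ) (hr : 0 < r)
    (h1 : rhoDist (fun L => (L.map a).prod) u v ≤ r)
    (h2 : rhoDist (fun L => (L.map a).prod) v w ≤ r) :
    rhoDist (fun L => (L.map a).prod) u w ≤ r := by
  rw [rhoDist_le_iff a ha _ _ _ hr] at *
  obtain ⟨n, hn, hp⟩ := h1
  obtain ⟨n', hn', hp'⟩ := h2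
  rcases le_total n n' with h | h
  · exact ⟨n, fun k hk => (hn k hk).trans (hn' k (by omega)), hp⟩
  · refine ⟨n', fun k hk => (hn k (by omega)).trans (hn' k hk), le_trans (le_of_eq ?_) hp'⟩
    refine Finset.prod_congr rfl fun k hk => ?_
    rw [hn k (by have := Finset.mem_range.mp hk; omega)]

/-- The stopping index, and the description of balls by it. -/
theorem exists_stop {G : Type*} (a : G → ℝ) (ha : ∀ i, a i ∈ Set.Ioo (0:ℝ) 1) [Finite G]
    (u : ℕ → G) (m : ℕ) :
    ∃ n : ℕ, (∀ v : ℕ → G, rhoDist (fun L => (L.map a).prod) u v ≤ Real.exp (-(m:ℝ)) ↔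
        ∀ k < n, u k = v k) ∧
      ∑ k ∈ Finset.range n, Real.log (a (u k)) ≤ -(m:ℝ) ∧
      ∀ l < n, -(m:ℝ) < ∑ k ∈ Finset.range l, Real.log (a (u k)) := by
  classical
  have hex : ∃ n : ℕ, ∏ k ∈ Finset.range n, a (u k) ≤ Real.exp (-(m:ℝ)) := by
    have : rhoDist (fun L => (L.map a).prod) u u ≤ Real.exp (-(m:ℝ)) := by
      unfold rhoDist
      rw [dif_pos rfl]
      exact (Real.exp_pos _).le
    rw [rhoDist_le_iff a ha _ _ _ (Real.exp_pos _)] at this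
    obtain ⟨n, -, hn⟩ := this
    exact ⟨n, hn⟩
  have hlog : ∀ n : ℕ, ∏ k ∈ Finset.range n, a (u k) =
      Real.exp (∑ k ∈ Finset.range n, Real.log (a (u k))) := by
    intro n
    rw [Real.exp_sum]
    exact Finset.prod_congr rfl fun k _ => (Real.exp_log (ha _).1).symm
  refine ⟨Nat.find hex, fun v => ?_, ?_, fun l hl => ?_⟩
  · rw [rhoDist_le_iff a ha _ _ _ (Real.exp_pos _)]
    constructor
    · rintro ⟨n, hn, hp⟩ k hk
      exact hn k (lt_of_lt_of_le hk (Nat.find_min' hex hp))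
    · intro h
      exact ⟨_, h, Nat.find_spec hex⟩
  · have := Nat.find_spec hex
    rwa [hlog, Real.exp_le_exp] at this
  · have := Nat.find_min hex hl
    rwa [hlog, Real.exp_le_exp, not_le] at this

theorem exists_rho_sep {G : Type*} (a : G → ℝ) (ha : ∀ i, a i ∈ Set.Ioo (0:ℝ) 1) [Finite G]
    (u : ℕ → G) (k : ℕ) : ∃ r : ℝ, 0 < r ∧ ∀ v : ℕ → G,
      rhoDist (fun L => (L.map a).prod) u v ≤ r → u k = v k := by
  have hpos : 0 < ∏ l ∈ Finset.range (k+1), a (u l) := Finset.prod_pos fun l _ => (ha _).1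
  refine ⟨(∏ l ∈ Finset.range (k+1), a (u l)) / 2, by positivity, fun v hv => ?_⟩
  rw [rhoDist_le_iff a ha _ _ _ (by positivity)] at hv
  obtain ⟨n, hn, hp⟩ := hv
  apply hn
  by_contra hcon
  have hle : n ≤ k + 1 := by omega
  rw [← Finset.prod_range_mul_prod_Ico (fun l => a (u l)) hle] at hp hpos
  have h1 : ∏ l ∈ Finset.Ico n (k+1), a (u l) ≤ 1 :=
    Finset.prod_le_one (fun k _ => (ha _).1.le) (fun k _ => (ha _).2.le)
  have h2 : 0 < ∏ l ∈ Finset.range n, a (u l) := Finset.prod_pos fun l _ => (ha _).1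
  nlinarith

end Metric

theorem gFun_eq_min {Γ₁ Γ₂ : Type*} [Fintype Γ₁] [Fintype Γ₂] (p : Γ₁ × Γ₂ → ℝ)
    (a : Γ₁ → ℝ) (b : Γ₂ → ℝ) (h1 : lyap1 p a < 0) (h2 : lyap2 p b < 0) :
    gFun p a b = -((∑ ij : Γ₁ × Γ₂, p ij * (Real.log (p ij) - Real.log (colSum p ij.1) -
        Real.log (rowSum p ij.2))) * min (-1 / lyap1 p a) (-1 / lyap2 p b) +
      (∑ ij : Γ₁ × Γ₂, p ij * Real.log (colSum p ij.1)) * (-1 / lyap1 p a) +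
      (∑ ij : Γ₁ × Γ₂, p ij * Real.log (rowSum p ij.2)) * (-1 / lyap2 p b)) := by
  simp only [mul_sub, Finset.sum_sub_distrib]
  have hmono : ∀ x y : ℝ, x < 0 → y < 0 → x ≤ y → -1 / x ≤ -1 / y := by
    intro x y hx hy hxy
    have h3 := one_div_le_one_div_of_neg_of_le hy hxy
    rw [neg_div, neg_div]
    linarith
  unfold gFun gOne gTwo
  split_ifs with h
  · rw [min_eq_right (hmono _ _ h2 h1 h)]
    ring
  · rw [min_eq_left (hmono _ _ h1 h2 (not_le.mp h).le)]
    ring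

/-- On a symbolic Barański carpet, the Bernoulli measure of a probability
vector `p` has Hausdorff dimension `g(p,a,b)`. -/
theorem stmt15 {Γ₁ Γ₂ : Type} [Fintype Γ₁] [Fintype Γ₂] [Nonempty Γ₁] [Nonempty Γ₂]
    (A : Set (Γ₁ × Γ₂)) (hA : A.Nonempty)
    (a : Γ₁ → ℝ) (b : Γ₂ → ℝ) (ha : ∀ i, a i ∈ Set.Ioo (0:ℝ) 1) (hb : ∀ j, b j ∈ Set.Ioo (0:ℝ) 1)
    [MetricSpace (ℕ → ↥A)]
    (hdist : ∀ ω₁ ω₂ : ℕ → ↥A, dist ω₁ ω₂ = baranskiDist A a b ω₁ ω₂)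
    [MeasurableSpace (ℕ → ↥A)] [BorelSpace (ℕ → ↥A)]
    (p : Γ₁ × Γ₂ → ℝ) (hp : IsProbVec A p)
    (ν : Measure (ℕ → ↥A)) (hprob : IsProbabilityMeasure ν) (hν : IsBernoulli A p ν) :
    dimHMeasure ν = ENNReal.ofReal (gFun p a b) := by
  classical
  obtain ⟨hp0, hpA, hp1⟩ := hp
  let _ : Fintype A := Fintype.ofFinite A
  -- the metric
  have hd : ∀ (x y : ℕ → A) (r : ℝ), dist x y ≤ r ↔
      rhoDist (fun L => (L.map a).prod) (fun k => ((x k : Γ₁ × Γ₂)).1)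
        (fun k => ((y k : Γ₁ × Γ₂)).1) ≤ r ∧
      rhoDist (fun L => (L.map b).prod) (fun k => ((x k : Γ₁ × Γ₂)).2)
        (fun k => ((y k : Γ₁ × Γ₂)).2) ≤ r := by
    intro x y r
    rw [hdist]
    unfold baranskiDist
    exact max_le_iff
  have hultra : IsUltrametricDist (ℕ → A) := by
    refine ⟨fun x y z => ?_⟩
    by_cases hxy : x = y
    · subst hxy; exact le_max_right _ _
    have hr : 0 < max (dist x y) (dist y z) := lt_max_of_lt_left (dist_pos.mpr hxy)
    have e1 := (hd x y _).mp (le_max_left (dist x y) (dist y z))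
    have e2 := (hd y z _).mp (le_max_right (dist x y) (dist y z))
    exact (hd x z _).mpr ⟨rhoDist_trans a ha _ _ _ _ hr e1.1 e2.1,
      rhoDist_trans b hb _ _ _ _ hr e1.2 e2.2⟩
  let Y : ℕ → (ℕ → A) → A := fun k ω => ω k
  have hY : ∀ k c, MeasurableSet {ω | Y k ω = c} := by
    intro k c
    apply IsOpen.measurableSet
    rw [isOpen_iff_mem_nhds]
    intro x hx
    obtain ⟨r1, hr1, h1⟩ := exists_rho_sep a ha (fun k => ((x k : Γ₁ × Γ₂)).1) k
    obtain ⟨r2, hr2, h2⟩ := exists_rho_sep b hb (fun k => ((x k : Γ₁ × Γ₂)).2) k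
    filter_upwards [closedBall_mem_nhds x (lt_min hr1 hr2)] with y hy
    rw [mem_closedBall, dist_comm, hd] at hy
    have e1 := h1 _ (hy.1.trans (min_le_left _ _))
    have e2 := h2 _ (hy.2.trans (min_le_right _ _))
    have : x k = y k := Subtype.ext (Prod.ext e1 e2)
    simp only [Y, mem_ofPred_eq] at hx ⊢
    rw [← this, hx]
  let P : A → ℝ := fun c => p c
  have hP0 : ∀ c, 0 ≤ P c := fun c => hp0 _
  have hsum : ∀ f : Γ₁ × Γ₂ → ℝ, ∑ c : A, P c * f c = ∑ ij : Γ₁ × Γ₂, p ij * f ij := by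
    intro f
    have e1 : ∑ c : A, P c * f c = ∑ ij ∈ Finset.univ.filter (· ∈ A), p ij * f ij :=
      (Finset.sum_subtype (Finset.univ.filter (· ∈ A)) (p := (· ∈ A)) (by simp)
        (fun ij => p ij * f ij)).symm
    rw [e1]
    apply Finset.sum_subset (Finset.subset_univ _)
    intro ij _ hij
    have : ij ∉ A := by simpa using hij
    rw [hpA ij this, zero_mul]
  have hP1 : ∑ c, P c = 1 := by
    have := hsum (fun _ => 1)
    simpa [hp1] using this
  have hμ : ∀ (m : ℕ) (w : Fin m → A),
      ν {ω | ∀ k : Fin m, Y k ω = w k} = ENNReal.ofReal (∏ k, P (w k)) := fun m w => hν m w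
  have hcol : ∀ i, ∑ c ∈ Finset.univ.filter (fun c : A => (c : Γ₁ × Γ₂).1 = i), P c =
      colSum p i := by
    intro i
    have := hsum (fun ij => if ij.1 = i then 1 else 0)
    rw [Finset.sum_filter]
    simp only [mul_ite, mul_one, mul_zero] at this
    rw [this, Fintype.sum_prod_type]
    unfold colSum
    rw [Finset.sum_eq_single i]
    · simp
    · intro j _ hj; simp [hj]
    · simp
  have hrow : ∀ j, ∑ c ∈ Finset.univ.filter (fun c : A => (c : Γ₁ × Γ₂).2 = j), P c =
      rowSum p j := by
    intro i
    have := hsum (fun ij => if ij.2 = i then 1 else 0)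
    rw [Finset.sum_filter]
    simp only [mul_ite, mul_one, mul_zero] at this
    rw [this, Fintype.sum_prod_type_right]
    unfold rowSum
    rw [Finset.sum_eq_single i]
    · simp
    · intro j _ hj; simp [hj]
    · simp
  -- Lyapunov exponents are negative
  have hneg : ∀ f : Γ₁ × Γ₂ → ℝ, (∀ ij, f ij < 0) → ∑ ij, p ij * f ij < 0 := by
    intro f hf
    apply Finset.sum_neg' (fun ij _ => mul_nonpos_of_nonneg_of_nonpos (hp0 ij) (hf ij).le)
    by_contra hcon
    push Not at hcon
    have : ∑ ij, p ij = 0 := by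
      apply Finset.sum_eq_zero
      intro ij _
      have h1 := hcon ij (Finset.mem_univ _)
      have h2 := hf ij
      have h3 := hp0 ij
      nlinarith
    rw [this] at hp1
    exact zero_ne_one hp1
  have hl1 : lyap1 p a < 0 := hneg _ fun ij => Real.log_neg (ha _).1 (ha _).2
  have hl2 : lyap2 p b < 0 := hneg _ fun ij => Real.log_neg (hb _).1 (hb _).2
  have hlow : ∀ {G : Type} [Fintype G] (f : G → ℝ), ∃ C, ∀ c, -C ≤ f c := by
    intro G _ f
    refine ⟨∑ c, |f c|, fun c => ?_⟩
    have h1 := Finset.single_le_sum (f := fun c => |f c|) (fun _ _ => abs_nonneg _)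
      (Finset.mem_univ c)
    have h2 := neg_abs_le (f c)
    linarith
  obtain ⟨Ca, hCa⟩ := hlow (fun i => Real.log (a i))
  obtain ⟨Cb, hCb⟩ := hlow (fun i => Real.log (b i))
  -- reduce to local dimensions
  rw [gFun_eq_min p a b hl1 hl2]
  apply billingsley
  have slln : ∀ f : Γ₁ × Γ₂ → ℝ, ∀ᵐ ω ∂ν, Tendsto (fun n : ℕ =>
      (∑ k ∈ Finset.range n, f (ω k)) / n) atTop (nhds (∑ ij, p ij * f ij)) := by
    intro f
    rw [← hsum f]
    exact slln_fin ν Y hY P hP0 hP1 hμ (fun c => f c)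
  filter_upwards [slln (fun ij => Real.log (p ij) - Real.log (colSum p ij.1) -
      Real.log (rowSum p ij.2)), slln (fun ij => Real.log (colSum p ij.1)),
      slln (fun ij => Real.log (rowSum p ij.2)), slln (fun ij => Real.log (a ij.1)),
      slln (fun ij => Real.log (b ij.2)), ae_pos ν Y hY P hP0 hμ] with x s0 s1 s2 s3 s4 hpos
  choose n1 hn1 hn1a hn1b using fun m : ℕ => exists_stop a ha (fun k => ((x k : Γ₁ × Γ₂)).1) m
  choose n2 hn2 hn2a hn2b using fun m : ℕ => exists_stop b hb (fun k => ((x k : Γ₁ × Γ₂)).2) m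
  obtain ⟨t1, l1⟩ := stop_asymp _ Ca (lyap1 p a) (fun k => hCa _) hl1 s3 n1 hn1a hn1b
  obtain ⟨t2, l2⟩ := stop_asymp _ Cb (lyap2 p b) (fun k => hCb _) hl2 s4 n2 hn2a hn2b
  have t0 : Tendsto (fun m => min (n1 m) (n2 m)) atTop atTop := by
    refine tendsto_atTop.mpr fun K => ?_
    filter_upwards [tendsto_atTop.mp t1 K, tendsto_atTop.mp t2 K] with m h h'
    exact le_min h h'
  have l0 : Tendsto (fun m : ℕ => ((min (n1 m) (n2 m) : ℕ) : ℝ) / m) atTop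
      (nhds (min (-1 / lyap1 p a) (-1 / lyap2 p b))) := by
    refine (l1.min l2).congr fun m => ?_
    rw [Nat.cast_min, min_div_div_right (Nat.cast_nonneg m)]
  have c0 := comp_asymp _ _ _ s0 _ t0 l0
  have c1 := comp_asymp _ _ _ s1 _ t1 l1
  have c2 := comp_asymp _ _ _ s2 _ t2 l2
  refine ⟨fun m => -((∑ k ∈ Finset.range (min (n1 m) (n2 m)),
      (Real.log (p (x k)) - Real.log (colSum p (x k : Γ₁ × Γ₂).1) -
        Real.log (rowSum p (x k : Γ₁ × Γ₂).2))) +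
      (∑ k ∈ Finset.range (n1 m), Real.log (colSum p (x k : Γ₁ × Γ₂).1)) +
      ∑ k ∈ Finset.range (n2 m), Real.log (rowSum p (x k : Γ₁ × Γ₂).2)), fun m => ?_, ?_⟩
  · -- mass of a ball
    let S : ℕ → Finset A := fun k => Finset.univ.filter (fun c : A =>
      (k < n1 m → (c : Γ₁ × Γ₂).1 = (x k : Γ₁ × Γ₂).1) ∧
      (k < n2 m → (c : Γ₁ × Γ₂).2 = (x k : Γ₁ × Γ₂).2))
    have hball : closedBall x (Real.exp (-(m:ℝ))) =
        {ω | ∀ k < max (n1 m) (n2 m), Y k ω ∈ S k} := by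
      ext y
      rw [mem_closedBall, dist_comm, hd, hn1, hn2]
      simp only [mem_ofPred_eq, S, Y, Finset.mem_filter, Finset.mem_univ, true_and]
      constructor
      · rintro ⟨h1, h2⟩ k _
        exact ⟨fun h => (h1 k h).symm, fun h => (h2 k h).symm⟩
      · intro h
        exact ⟨fun k hk => ((h k (lt_max_of_lt_left hk)).1 hk).symm,
          fun k hk => ((h k (lt_max_of_lt_right hk)).2 hk).symm⟩
    have hq : ∀ k, 0 < colSum p (x k : Γ₁ × Γ₂).1 := by
      intro k
      rw [← hcol]
      refine lt_of_lt_of_le (hpos k) ?_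
      exact Finset.single_le_sum (f := P) (fun c _ => hP0 c) (by simp [Y])
    have hr : ∀ k, 0 < rowSum p (x k : Γ₁ × Γ₂).2 := by
      intro k
      rw [← hrow]
      refine lt_of_lt_of_le (hpos k) ?_
      exact Finset.single_le_sum (f := P) (fun c _ => hP0 c) (by simp [Y])
    have hfac : ∀ k, ∑ c ∈ S k, P c = Real.exp (
        (if k < min (n1 m) (n2 m) then (Real.log (p (x k)) -
          Real.log (colSum p (x k : Γ₁ × Γ₂).1) - Real.log (rowSum p (x k : Γ₁ × Γ₂).2)) else 0) +
        (if k < n1 m then Real.log (colSum p (x k : Γ₁ × Γ₂).1) else 0) +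
        (if k < n2 m then Real.log (rowSum p (x k : Γ₁ × Γ₂).2) else 0)) := by
      intro k
      by_cases h1 : k < n1 m <;> by_cases h2 : k < n2 m
      · rw [if_pos (lt_min h1 h2), if_pos h1, if_pos h2]
        have : S k = {x k} := by
          ext c
          simp only [S, h1, h2, Finset.mem_filter, Finset.mem_univ, true_and, forall_true_left,
            Finset.mem_singleton]
          exact ⟨fun h => Subtype.ext (Prod.ext h.1 h.2), fun h => by simp [h]⟩
        have e : ∀ u v w : ℝ, u - v - w + v + w = u := fun u v w => by ring
        rw [this, Finset.sum_singleton, e]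
        exact (Real.exp_log (hpos k)).symm
      · rw [if_neg (fun h => h2 (h.trans_le (min_le_right _ _))), if_pos h1, if_neg h2, zero_add,
          add_zero, Real.exp_log (hq k), ← hcol]
        simp [S, h1, h2]
      · rw [if_neg (fun h => h1 (h.trans_le (min_le_left _ _))), if_neg h1, if_pos h2, zero_add,
          zero_add, Real.exp_log (hr k), ← hrow]
        simp [S, h1, h2]
      · rw [if_neg (fun h => h1 (h.trans_le (min_le_left _ _))), if_neg h1, if_neg h2]
        simpa [S, h1, h2] using hP1
    have hite : ∀ (n M : ℕ) (f : ℕ → ℝ), n ≤ M →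
        ∑ k ∈ Finset.range M, (if k < n then f k else 0) = ∑ k ∈ Finset.range n, f k := by
      intro n M f hnM
      rw [← Finset.sum_filter]
      congr 1
      ext k
      simp only [Finset.mem_filter, Finset.mem_range]
      omega
    rw [hball, cyl_prod ν Y hY P hP0 hμ]
    congr 1
    rw [Finset.prod_congr rfl (fun k _ => hfac k), ← Real.exp_sum, neg_neg,
      Finset.sum_add_distrib, Finset.sum_add_distrib,
      hite _ _ _ ((min_le_left _ _).trans (le_max_left _ _)), hite _ _ _ (le_max_left _ _),
      hite _ _ _ (le_max_right _ _)]
  · refine (((c0.add c1).add c2).neg).congr fun m => ?_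
    rw [neg_div, add_div, add_div]

end
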